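/- arXiv:2307.04323 — 2 statements merged into one kernel-verified Lean document; each statement's English description precedes it below -/
import Mathlib

section
/- Let n = (q^m−1)/(q−1) − (q^{|A₁|} + q^{|A₂|} − 2)/(q−1) and d = q^{m−1} − q^{|A₁|−1} − q^{|A₂|−1}, where A₁, A₂ are disjoint nonempty subsets of [m] with |A_i| ≤ m−2. Then any q-ary linear code of length n − q − 1 and minimum distance d has dimension at most m − 2; consequently the [n, m, d] code C_{D^c} attains the generalized Cadambe–Mazumdar bound k ≤ min_s { 2s + k_opt^{(q)}(n − s(q+1), d) } with equality (taking s = 1, r = 2, δ = q). -/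
open Matrix Finset

/-- `k_opt^{(q)}(n,d)`: the largest dimension of a `q`-ary linear code of length `n`
and minimum distance at least `d`. -/
noncomputable def kopt (F : Type*) [Field F] [Fintype F] [DecidableEq F] (n d : ℕ) : ℕ :=
  sSup {k | ∃ C : Submodule F (Fin n → F),
    Module.finrank F ↥C = k ∧ ∀ c ∈ C, c ≠ 0 → d ≤ hammingNorm c}

open Classical in
lemma card_func {F U : Type*} [Field F] [Fintype F] [AddCommGroup U] [Module F U] [Fintype U]
    (f : U →ₗ[F] F) (hf : f ≠ 0) :
    Fintype.card F * (univ.filter (fun x : U => f x ≠ 0)).card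
      = (Fintype.card F - 1) * Fintype.card U := by
  have hs : Function.Surjective f := LinearMap.surjective hf
  have e := (LinearMap.quotKerEquivOfSurjective f hs).toEquiv
  have h1 := Submodule.card_eq_card_quotient_mul_card (LinearMap.ker f)
  rw [Nat.card_congr e] at h1
  simp only [Nat.card_eq_fintype_card] at h1
  have h2 : Fintype.card (LinearMap.ker f) = (univ.filter (fun x : U => f x = 0)).card := by
    rw [Fintype.card_subtype]
    simp [LinearMap.mem_ker]
  have h3 := Finset.card_filter_add_card_filter_not (s := (univ : Finset U)) (fun x : U => f x = 0)
  rw [Finset.card_univ] at h3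
  rw [h2] at h1
  have hq : 1 ≤ Fintype.card F := Fintype.card_pos
  obtain ⟨p, hp⟩ := Nat.exists_eq_add_of_le hq
  rw [hp] at h1 ⊢
  simp only [ne_eq, Nat.add_sub_cancel_left]
  set A := (univ.filter (fun x : U => f x = 0)).card
  set B := (univ.filter (fun x : U => ¬ f x = 0)).card
  rw [h1] at h3 ⊢
  have : B = p * A := by nlinarith [mul_comm A (1+p)]
  rw [this]; ring

open Classical in
lemma card_func_le {F U : Type*} [Field F] [Fintype F] [AddCommGroup U] [Module F U] [Fintype U]
    (f : U →ₗ[F] F) :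
    Fintype.card F * (univ.filter (fun x : U => f x ≠ 0)).card
      ≤ (Fintype.card F - 1) * Fintype.card U := by
  by_cases hf : f = 0
  · simp [hf]
  · exact (card_func f hf).le

lemma plotkin {F : Type*} [Field F] [Fintype F] [DecidableEq F] {N d : ℕ}
    (C : Submodule F (Fin N → F)) (h : ∀ c ∈ C, c ≠ 0 → d ≤ hammingNorm c) :
    Fintype.card F * ((Fintype.card F ^ Module.finrank F C - 1) * d) ≤
      N * ((Fintype.card F - 1) * Fintype.card F ^ Module.finrank F C) := by
  classical
  have hc : Fintype.card C = Fintype.card F ^ Module.finrank F C := Module.card_eq_pow_finrank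
  rw [← hc]
  have h1 : (Fintype.card C - 1) * d ≤ ∑ c : C, hammingNorm (c : Fin N → F) := by
    calc (Fintype.card C - 1) * d = ∑ c ∈ (univ.erase (0 : C)), d := by
          simp [Finset.card_erase_of_mem]
      _ ≤ ∑ c ∈ (univ.erase (0 : C)), hammingNorm (c : Fin N → F) := by
          apply Finset.sum_le_sum
          intro c hc
          apply h c c.2
          simpa using hc
      _ ≤ _ := Finset.sum_le_sum_of_subset (Finset.erase_subset _ _)
  have h2 : ∑ c : C, hammingNorm (c : Fin N → F)
      = ∑ i : Fin N, (univ.filter (fun c : C => (c : Fin N → F) i ≠ 0)).card := by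
    simp only [hammingNorm, Finset.card_filter]
    rw [Finset.sum_comm]
  calc _ ≤ Fintype.card F * ∑ c : C, hammingNorm (c : Fin N → F) := Nat.mul_le_mul_left _ h1
    _ = ∑ i : Fin N, Fintype.card F * (univ.filter (fun c : C => (c : Fin N → F) i ≠ 0)).card := by
      rw [h2, Finset.mul_sum]
    _ ≤ ∑ i : Fin N, (Fintype.card F - 1) * Fintype.card C := by
      apply Finset.sum_le_sum
      intro i _
      have := card_func_le ((LinearMap.proj i : (Fin N → F) →ₗ[F] F).comp C.subtype)
      refine le_trans (le_of_eq ?_) this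
      congr!
    _ = _ := by simp

lemma le_kopt {F K ι : Type*} [Field F] [Fintype F] [DecidableEq F] [AddCommGroup K] [Module F K]
    [Fintype ι] {N d : ℕ} (hd : 0 < d) (hN : Fintype.card ι ≤ N)
    (φ : K →ₗ[F] (ι → F)) (h : ∀ y, y ≠ 0 → d ≤ hammingNorm (φ y)) :
    Module.finrank F K ≤ kopt F N d := by
  classical
  obtain ⟨e⟩ : Nonempty (ι ↪ Fin N) :=
    Function.Embedding.nonempty_of_card_le (by simpa using hN)
  let E := Function.ExtendByZero.linearMap F (e : ι → Fin N)
  have hE : ∀ x : ι → F, hammingNorm x ≤ hammingNorm (E x) := by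
    intro x
    unfold hammingNorm
    apply Finset.card_le_card_of_injOn e
    · intro i hi
      simp only [Finset.coe_filter, Finset.mem_univ, true_and, Set.mem_ofPred_eq] at hi ⊢
      change ¬ Function.extend e x 0 (e i) = 0
      rw [e.injective.extend_apply]; exact hi
    · exact e.injective.injOn
  have hinj : Function.Injective (E ∘ₗ φ) := by
    rw [← LinearMap.ker_eq_bot, LinearMap.ker_eq_bot']
    intro y hy
    by_contra hne
    have h1 := (h y hne).trans (hE _)
    rw [LinearMap.comp_apply] at hy
    rw [hy] at h1
    simp at h1; omega
  unfold kopt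
  apply le_csSup
  · refine ⟨N, ?_⟩
    rintro k ⟨C, hC, -⟩
    rw [← hC]
    simpa using Submodule.finrank_le C
  · refine ⟨LinearMap.range (E ∘ₗ φ), LinearMap.finrank_range_of_inj hinj, ?_⟩
    rintro _ ⟨y, rfl⟩ hne
    have : y ≠ 0 := by rintro rfl; simp at hne
    exact (h y this).trans (hE _)

lemma kopt_le {F : Type*} [Field F] [Fintype F] [DecidableEq F] {N d k : ℕ}
    (h : ∀ C : Submodule F (Fin N → F), (∀ c ∈ C, c ≠ 0 → d ≤ hammingNorm c) →
      Module.finrank F C ≤ k) : kopt F N d ≤ k := by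
  unfold kopt
  apply csSup_le'
  rintro _ ⟨C, rfl, hC⟩
  exact h C hC

open Classical in
/-- counting projective points of a scaling-invariant set -/
lemma card_proj {F V : Type*} [Field F] [Fintype F] [AddCommGroup V] [Module F V] [Fintype V]
    [Fintype (Projectivization F V)]
    (T : V → Prop) (h0 : ¬ T 0) (hT : ∀ (u : Fˣ) v, T (u • v) ↔ T v) :
    (univ.filter T).card =
      (Fintype.card F - 1) * (univ.filter (fun p : Projectivization F V => T p.rep)).card := by
  rw [← Fintype.card_units, mul_comm, ← Finset.card_univ (α := Fˣ), ← Finset.card_product]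
  symm
  apply Finset.card_bij (fun x _ => x.2 • x.1.rep)
  · rintro ⟨p, u⟩ h
    simpa [hT] using h
  · rintro ⟨p, u⟩ h ⟨p', u'⟩ h' heq
    simp only at heq
    have hp : p = p' := by
      rw [← p.mk_rep, ← p'.mk_rep, Projectivization.mk_eq_mk_iff]
      refine ⟨u⁻¹ * u', ?_⟩
      rw [mul_smul, ← heq, inv_smul_smul]
    subst hp
    have : (u : F) = u' := by
      have : (u : F) • p.rep = (u' : F) • p.rep := heq
      exact smul_left_injective F p.rep_nonzero this
    rw [Units.ext this]
  · intro v hv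
    have hv' : T v := by simpa using hv
    have hne : v ≠ 0 := by rintro rfl; exact h0 hv'
    obtain ⟨a, ha⟩ := Projectivization.exists_smul_eq_mk_rep F v hne
    refine ⟨⟨Projectivization.mk F v hne, a⁻¹⟩, ?_, ?_⟩
    · simp [← ha, hT, hv']
    · simp [← ha]

def cs (F : Type*) [Field F] {m : ℕ} (S : Finset (Fin m)) : Submodule F (Fin m → F) where
  carrier := {x | ∀ j, j ∉ S → x j = 0}
  add_mem' := by intro a b ha hb j hj; simp [ha j hj, hb j hj]
  zero_mem' := by intro j _; rfl
  smul_mem' := by intro c a ha j hj; simp [ha j hj]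

lemma mem_cs {F : Type*} [Field F] {m : ℕ} {S : Finset (Fin m)} {x : Fin m → F} :
    x ∈ cs F S ↔ ∀ j, j ∉ S → x j = 0 := Iff.rfl

open Classical in
lemma card_cs {F : Type*} [Field F] [Fintype F] {m : ℕ} (S : Finset (Fin m)) :
    (univ.filter (fun x => x ∈ cs F S)).card = Fintype.card F ^ S.card := by
  have : univ.filter (fun x => x ∈ cs F S) =
      Fintype.piFinset (fun j => if j ∈ S then (univ : Finset F) else {0}) := by
    ext x
    simp only [Finset.mem_filter, Finset.mem_univ, true_and, mem_cs, Fintype.mem_piFinset]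
    apply forall_congr'
    intro j
    by_cases h : j ∈ S <;> simp [h]
  rw [this, Fintype.card_piFinset]
  simp only [apply_ite Finset.card, Finset.card_univ, Finset.card_singleton]
  rw [Finset.prod_ite]
  simp

open Classical in
lemma card_cs_func {F : Type*} [Field F] [Fintype F] {m : ℕ} (S : Finset (Fin m))
    (hS : S.Nonempty) (f : (Fin m → F) →ₗ[F] F) :
    (univ.filter (fun x => x ∈ cs F S ∧ f x ≠ 0)).card
      ≤ (Fintype.card F - 1) * Fintype.card F ^ (S.card - 1) := by
  have h := card_func_le (f.comp (cs F S).subtype)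
  have e1 : Fintype.card (cs F S) = Fintype.card F ^ S.card := by
    rw [← card_cs, Fintype.card_subtype]
  have e2 : (univ.filter (fun x : cs F S => (f.comp (cs F S).subtype) x ≠ 0)).card =
      (univ.filter (fun x => x ∈ cs F S ∧ f x ≠ 0)).card := by
    apply Finset.card_bij (fun (x : cs F S) _ => x.1)
    · intro x hx
      rw [Finset.mem_filter] at hx
      exact Finset.mem_filter.2 ⟨Finset.mem_univ _, x.2, hx.2⟩
    · intro x _ y _ h; exact Subtype.ext h
    · intro x hx
      simp only [Finset.mem_filter, Finset.mem_univ, true_and] at hx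
      exact ⟨⟨x, hx.1⟩, Finset.mem_filter.2 ⟨Finset.mem_univ _, hx.2⟩, rfl⟩
  rw [e1, e2] at h
  have hpos := hS.card_pos
  obtain ⟨t, ht⟩ : ∃ t, S.card = t + 1 := ⟨S.card - 1, by omega⟩
  rw [ht] at h ⊢
  simp only [Nat.add_sub_cancel]
  have hq : 0 < Fintype.card F := Fintype.card_pos
  apply Nat.le_of_mul_le_mul_left _ hq
  calc _ ≤ _ := h
    _ = _ := by rw [pow_succ]; ring

open Classical in
lemma card_compl {F : Type*} [Field F] [Fintype F] {m : ℕ} (A₁ A₂ : Finset (Fin m))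
    (hdisj : Disjoint A₁ A₂) :
    (univ.filter (fun x => x ∉ cs F A₁ ∧ x ∉ cs F A₂)).card
      + Fintype.card F ^ A₁.card + Fintype.card F ^ A₂.card = Fintype.card F ^ m + 1 := by
  have h1 := Finset.card_union_add_card_inter (univ.filter (fun x => x ∈ cs F A₁))
    (univ.filter (fun x => x ∈ cs F A₂))
  have h2 : (univ.filter (fun x => x ∈ cs F A₁)) ∩ (univ.filter (fun x => x ∈ cs F A₂)) = {0} := by
    ext x
    simp only [Finset.mem_inter, Finset.mem_filter, Finset.mem_univ, true_and,
      Finset.mem_singleton]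
    constructor
    · rintro ⟨ha, hb⟩
      funext j
      by_cases hj : j ∈ A₁
      · exact hb j (Finset.disjoint_left.mp hdisj hj)
      · exact ha j hj
    · rintro rfl
      exact ⟨Submodule.zero_mem _, Submodule.zero_mem _⟩
  rw [h2, ← Finset.filter_or, card_cs, card_cs, Finset.card_singleton] at h1
  have h3 := Finset.card_filter_add_card_filter_not (s := (univ : Finset (Fin m → F)))
    (fun x => x ∈ cs F A₁ ∨ x ∈ cs F A₂)
  simp only [not_or] at h3
  rw [Finset.card_univ, Fintype.card_fun, Fintype.card_fin] at h3
  omega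

open Classical in
lemma weight_ge {F : Type*} [Field F] [Fintype F] {m : ℕ} (A₁ A₂ : Finset (Fin m))
    (h1 : A₁.Nonempty) (h2 : A₂.Nonempty) (f : (Fin m → F) →ₗ[F] F) (hf : f ≠ 0) {d : ℕ}
    (hd : d + Fintype.card F ^ (A₁.card - 1) + Fintype.card F ^ (A₂.card - 1)
      = Fintype.card F ^ (m - 1)) :
    (Fintype.card F - 1) * d ≤
    (univ.filter (fun x => x ∉ cs F A₁ ∧ x ∉ cs F A₂ ∧ f x ≠ 0)).card := by
  have hm : 0 < m := by
    obtain ⟨i, _⟩ := h1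
    exact i.pos
  have hq : 0 < Fintype.card F := Fintype.card_pos
  have e := card_func f hf
  rw [Fintype.card_fun, Fintype.card_fin] at e
  have e' : (univ.filter (fun x => f x ≠ 0)).card =
      (Fintype.card F - 1) * Fintype.card F ^ (m - 1) := by
    obtain ⟨t, rfl⟩ : ∃ t, m = t + 1 := ⟨m - 1, by omega⟩
    apply Nat.eq_of_mul_eq_mul_left hq
    rw [e, pow_succ]; simp only [Nat.add_sub_cancel]; ring
  have a1 := card_cs_func A₁ h1 f
  have a2 := card_cs_func A₂ h2 f
  have hsub : univ.filter (fun x => f x ≠ 0) ⊆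
      (univ.filter (fun x => x ∉ cs F A₁ ∧ x ∉ cs F A₂ ∧ f x ≠ 0)) ∪
      ((univ.filter (fun x => x ∈ cs F A₁ ∧ f x ≠ 0)) ∪
       (univ.filter (fun x => x ∈ cs F A₂ ∧ f x ≠ 0))) := by
    intro x
    simp only [Finset.mem_union, Finset.mem_filter, Finset.mem_univ, true_and]
    tauto
  have := (Finset.card_le_card hsub).trans ((Finset.card_union_le _ _).trans
    (Nat.add_le_add_left (Finset.card_union_le _ _) _))
  rw [e', ← hd, mul_add, mul_add] at this
  omega

open Classical in
lemma shorten {F : Type*} [Field F] [Fintype F] {m : ℕ} (A₁ A₂ : Finset (Fin m))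
    (h1 : A₁.Nonempty) (h2 : A₂.Nonempty) (hdisj : Disjoint A₁ A₂) {n d s : ℕ}
    (hd : d + Fintype.card F ^ (A₁.card - 1) + Fintype.card F ^ (A₂.card - 1)
      = Fintype.card F ^ (m - 1)) (hd0 : 0 < d)
    (hn : n * (Fintype.card F - 1) + Fintype.card F ^ A₁.card + Fintype.card F ^ A₂.card
      = Fintype.card F ^ m + 1)
    (W : Submodule F (Fin m → F)) (hW : Module.finrank F W ≤ 2 * s)
    (hc : (Fintype.card F - 1) * (s * (Fintype.card F + 1)) ≤
      (univ.filter (fun x => (x ∉ cs F A₁ ∧ x ∉ cs F A₂) ∧ x ∈ W)).card) :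
    m ≤ 2 * s + kopt F (n - s * (Fintype.card F + 1)) d := by
  have hq : 1 < Fintype.card F := Fintype.one_lt_card
  have hq' : 0 < Fintype.card F - 1 := by omega
  have : Finite (Projectivization F (Fin m → F)) := inferInstance
  let : Fintype (Projectivization F (Fin m → F)) := Fintype.ofFinite _
  have hsm : ∀ (W : Submodule F (Fin m → F)) (u : Fˣ) v, u • v ∈ W ↔ v ∈ W :=
    fun W u v => Submodule.smul_mem_iff_of_isUnit W u.isUnit
  let ι := {p : Projectivization F (Fin m → F) //
    (p.rep ∉ cs F A₁ ∧ p.rep ∉ cs F A₂) ∧ p.rep ∉ W}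
  let φ : W.dualAnnihilator →ₗ[F] (ι → F) :=
    LinearMap.pi (fun p => (LinearMap.applyₗ p.1.rep).comp W.dualAnnihilator.subtype)
  have hcard : Fintype.card ι ≤ n - s * (Fintype.card F + 1) := by
    rw [Fintype.card_subtype]
    apply Nat.le_of_mul_le_mul_left _ hq'
    have e3 : (univ.filter (fun x => (x ∉ cs F A₁ ∧ x ∉ cs F A₂) ∧ x ∉ W)).card =
        (Fintype.card F - 1) * (univ.filter (fun p : Projectivization F (Fin m → F) =>
          (p.rep ∉ cs F A₁ ∧ p.rep ∉ cs F A₂) ∧ p.rep ∉ W)).card := by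
      convert card_proj (fun x : Fin m → F => (x ∉ cs F A₁ ∧ x ∉ cs F A₂) ∧ x ∉ W)
        (by simp) (by intro u v; rw [hsm, hsm, hsm])
    rw [← e3]
    have e1 := card_compl (F := F) A₁ A₂ hdisj
    have e2 := Finset.card_filter_add_card_filter_not
      (s := univ.filter (fun x => x ∉ cs F A₁ ∧ x ∉ cs F A₂)) (fun x => x ∈ W)
    rw [Finset.filter_filter, Finset.filter_filter] at e2
    rw [Nat.mul_sub, mul_comm _ n]
    omega
  have hφ : ∀ y, y ≠ 0 → d ≤ hammingNorm (φ y) := by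
    intro y hy
    have hy' : (y : Module.Dual F (Fin m → F)) ≠ 0 := by simpa using hy
    have hw := weight_ge A₁ A₂ h1 h2 y.1 hy' hd
    have e3 : (univ.filter (fun x => x ∉ cs F A₁ ∧ x ∉ cs F A₂ ∧ y.1 x ≠ 0)).card =
        (Fintype.card F - 1) * (univ.filter (fun p : Projectivization F (Fin m → F) =>
          p.rep ∉ cs F A₁ ∧ p.rep ∉ cs F A₂ ∧ y.1 p.rep ≠ 0)).card := by
      convert card_proj (fun x : Fin m → F => x ∉ cs F A₁ ∧ x ∉ cs F A₂ ∧ y.1 x ≠ 0) (by simp) (by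
        intro u v
        rw [hsm, hsm]
        have : y.1 (u • v) = (u : F) * y.1 v := by
          have : u • v = (u : F) • v := rfl
          rw [this, map_smul, smul_eq_mul]
        rw [this]; simp)
    rw [e3] at hw
    refine (Nat.le_of_mul_le_mul_left hw hq').trans ?_
    unfold hammingNorm
    rw [← Finset.card_map (Function.Embedding.subtype _)]
    apply Finset.card_le_card
    intro p hp
    simp only [Finset.mem_filter, Finset.mem_univ, true_and] at hp
    rw [Finset.mem_map]
    refine ⟨⟨p, ⟨hp.1, hp.2.1⟩, ?_⟩, ?_, rfl⟩
    · intro hmem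
      exact hp.2.2 ((Submodule.mem_dualAnnihilator _).1 y.2 _ hmem)
    · rw [Finset.mem_filter]
      exact ⟨Finset.mem_univ _, hp.2.2⟩
  have := le_kopt (F := F) (K := ↥W.dualAnnihilator) hd0 hcard φ hφ
  have e := Subspace.finrank_add_finrank_dualAnnihilator_eq W
  rw [Module.finrank_fin_fun] at e
  omega

open Classical in
lemma exists_line {F : Type*} [Field F] [Fintype F] {m : ℕ} (A₁ A₂ : Finset (Fin m))
    (hm : 2 ≤ m) (hc1 : A₁.card ≤ m - 2) (hc2 : A₂.card ≤ m - 2) :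
    ∃ W : Submodule F (Fin m → F), Module.finrank F W ≤ 2 ∧
    (Fintype.card F - 1) * (Fintype.card F + 1) ≤
      (univ.filter (fun x => (x ∉ cs F A₁ ∧ x ∉ cs F A₂) ∧ x ∈ W)).card := by
  have key : ∃ x1 x2 y1 y2 : Fin m, x1 ∉ A₁ ∧ x2 ∉ A₁ ∧ y1 ∉ A₂ ∧ y2 ∉ A₂ ∧
      x1 ≠ x2 ∧ y1 ≠ y2 ∧ x1 ≠ y2 ∧ y1 ≠ x2 := by
    have g1 : 1 < (A₁ᶜ).card := by rw [Finset.card_compl, Fintype.card_fin]; omega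
    have g2 : 1 < (A₂ᶜ).card := by rw [Finset.card_compl, Fintype.card_fin]; omega
    obtain ⟨x1, hx1, x2, hx2, hx⟩ := Finset.one_lt_card.1 g1
    obtain ⟨y1, hy1, y2, hy2, hy⟩ := Finset.one_lt_card.1 g2
    rw [Finset.mem_compl] at hx1 hx2 hy1 hy2
    by_cases h : x1 ≠ y2 ∧ y1 ≠ x2
    · exact ⟨x1, x2, y1, y2, hx1, hx2, hy1, hy2, hx, hy, h.1, h.2⟩
    · refine ⟨x1, x2, y2, y1, hx1, hx2, hy2, hy1, hx, hy.symm, ?_, ?_⟩ <;> grind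
  obtain ⟨x1, x2, y1, y2, hx1, hx2, hy1, hy2, hx, hy, h12, h21⟩ := key
  let u : Fin m → F := fun j => if j = x1 ∨ j = y1 then 1 else 0
  let v : Fin m → F := fun j => if j = x2 ∨ j = y2 then 1 else 0
  refine ⟨Submodule.span F {u, v}, ?_, ?_⟩
  · have := finrank_span_finset_le_card (R := F) ({u, v} : Finset (Fin m → F))
    rw [Finset.coe_pair] at this
    exact this.trans Finset.card_le_two
  have ux1 : u x1 = 1 := by simp [u]
  have ux2 : u x2 = 0 := by simp [u, hx.symm, h21.symm]
  have uy1 : u y1 = 1 := by simp [u]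
  have uy2 : u y2 = 0 := by simp [u, hy.symm, h12.symm]
  have vx1 : v x1 = 0 := by simp [v, hx, h12]
  have vx2 : v x2 = 1 := by simp [v]
  have vy1 : v y1 = 0 := by simp [v, hy, h21]
  have vy2 : v y2 = 1 := by simp [v]
  have hcard : (Fintype.card F - 1) * (Fintype.card F + 1) =
      (univ.erase (0 : F × F)).card := by
    rw [Finset.card_erase_of_mem (Finset.mem_univ _), Finset.card_univ, Fintype.card_prod,
      mul_comm, ← Nat.mul_self_sub_mul_self_eq, one_mul]
  rw [hcard]
  apply Finset.card_le_card_of_injOn (fun c => c.1 • u + c.2 • v)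
  · rintro ⟨a, b⟩ h
    simp only [Finset.coe_erase, Finset.coe_univ, Set.mem_sdiff, Set.mem_univ, true_and,
      Set.mem_singleton_iff] at h
    simp only [Finset.coe_filter, Finset.mem_univ, true_and, Set.mem_ofPred_eq]
    refine ⟨⟨?_, ?_⟩, Submodule.mem_span_pair.2 ⟨a, b, rfl⟩⟩
    · intro hm
      have e1 := hm x1 hx1
      have e2 := hm x2 hx2
      simp [ux1, ux2, vx1, vx2] at e1 e2
      exact h (by simp [e1, e2])
    · intro hm
      have e1 := hm y1 hy1
      have e2 := hm y2 hy2
      simp [uy1, uy2, vy1, vy2] at e1 e2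
      exact h (by simp [e1, e2])
  · rintro ⟨a, b⟩ _ ⟨a', b'⟩ _ h
    have e1 := congrFun h x1
    have e2 := congrFun h x2
    simp [ux1, ux2, vx1, vx2] at e1 e2
    simp [e1, e2]

lemma arith_s (q s a b : ℕ) (hq : 2 ≤ q) (hs : 2 ≤ s) (ha : a ≤ 2 * s - 2) (hb : b ≤ 2 * s - 2) :
    (q - 1) * (s * (q + 1)) + q ^ a + q ^ b ≤ q ^ (2 * s) := by
  have h1 : q ^ a ≤ q ^ (2 * s - 2) := Nat.pow_le_pow_right (by omega) ha
  have h2 : q ^ b ≤ q ^ (2 * s - 2) := Nat.pow_le_pow_right (by omega) hb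
  obtain ⟨t, rfl⟩ : ∃ t, s = t + 2 := ⟨s - 2, by omega⟩
  obtain ⟨p, rfl⟩ : ∃ p, q = p + 2 := ⟨q - 2, by omega⟩
  have e : (p + 2) ^ (2 * (t + 2)) = (p + 2) ^ (2 * (t + 2) - 2) * (p + 2) ^ 2 := by
    rw [← pow_add]; congr 1
  have h3 : 3 * (t + 2) ≤ 2 * (p + 2) ^ (2 * (t + 2) - 2) := by
    have : 4 * (t + 1) ≤ (p + 2) ^ (2 * (t + 2) - 2) := by
      calc 4 * (t + 1) ≤ 4 * 4 ^ t := by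
            have := Nat.lt_pow_self (n := t) (show 1 < 4 by norm_num)
            omega
        _ = 2 ^ (2 * (t + 2) - 2) := by
            rw [show 2 * (t + 2) - 2 = 2 * (t + 1) by omega, pow_mul, pow_succ]; norm_num; ring
        _ ≤ _ := Nat.pow_le_pow_left (by omega) _
    omega
  rw [e]
  set X := (p + 2) ^ (2 * (t + 2) - 2)
  have : (p + 2 - 1) * ((t + 2) * (p + 2 + 1)) = (t + 2) * ((p + 1) * (p + 3)) := by
    rw [show p + 2 - 1 = p + 1 by omega]; ring
  rw [this]
  nlinarith [Nat.mul_le_mul_right ((p + 1) * (p + 3)) h3, Nat.zero_le (X * p), Nat.zero_le (X * p * p)]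

open Classical in
lemma exists_W {F : Type*} [Field F] [Fintype F] {m s : ℕ} (A₁ A₂ : Finset (Fin m))
    (hm : 2 ≤ m) (hc1 : A₁.card ≤ m - 2) (hc2 : A₂.card ≤ m - 2) (hs : 2 ≤ s) (hsm : 2 * s ≤ m) :
    ∃ W : Submodule F (Fin m → F), Module.finrank F W ≤ 2 * s ∧
    (Fintype.card F - 1) * (s * (Fintype.card F + 1)) ≤
      (univ.filter (fun x => (x ∉ cs F A₁ ∧ x ∉ cs F A₂) ∧ x ∈ W)).card := by
  have g1 : 2 ≤ (A₁ᶜ).card := by rw [Finset.card_compl, Fintype.card_fin]; omega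
  have g2 : 2 ≤ (A₂ᶜ).card := by rw [Finset.card_compl, Fintype.card_fin]; omega
  obtain ⟨X, hX, hXc⟩ := Finset.exists_subset_card_eq g1
  obtain ⟨Y, hY, hYc⟩ := Finset.exists_subset_card_eq g2
  have hXY : (X ∪ Y).card ≤ 2 * s := by
    have := Finset.card_union_le X Y
    omega
  obtain ⟨S, hS, hSc⟩ := Finset.exists_superset_card_eq hXY (by simpa using hsm)
  have hq : 1 < Fintype.card F := Fintype.one_lt_card
  have cnt : ∀ A Z : Finset (Fin m), Z ⊆ Aᶜ → Z ⊆ S → Z.card = 2 → (S ∩ A).card ≤ 2 * s - 2 := by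
    intro A Z hZA hZS hZ
    have hd : Disjoint (S ∩ A) Z := by
      rw [Finset.disjoint_left]
      intro x hx hz
      exact (Finset.mem_compl.1 (hZA hz)) (Finset.mem_inter.1 hx).2
    have : ((S ∩ A) ∪ Z).card ≤ S.card :=
      Finset.card_le_card (Finset.union_subset Finset.inter_subset_left hZS)
    rw [Finset.card_union_of_disjoint hd] at this
    omega
  have ha := cnt A₁ X hX (Finset.subset_union_left.trans hS) hXc
  have hb := cnt A₂ Y hY (Finset.subset_union_right.trans hS) hYc
  refine ⟨cs F S, ?_, ?_⟩
  · have e1 : Fintype.card (cs F S) = Fintype.card F ^ S.card := by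
      rw [← card_cs, Fintype.card_subtype]
    rw [Module.card_eq_pow_finrank (K := F)] at e1
    have := Nat.pow_right_injective hq e1
    omega
  · have har := arith_s (Fintype.card F) s _ _ hq hs ha hb
    rw [← card_cs (F := F), ← card_cs (F := F), ← hSc, ← card_cs (F := F)] at har
    have hsub : univ.filter (fun x => x ∈ cs F S) ⊆
        (univ.filter (fun x => (x ∉ cs F A₁ ∧ x ∉ cs F A₂) ∧ x ∈ cs F S)) ∪
        ((univ.filter (fun x => x ∈ cs F (S ∩ A₁))) ∪
         (univ.filter (fun x => x ∈ cs F (S ∩ A₂)))) := by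
      intro x
      have : ∀ A, x ∈ cs F S → x ∈ cs F A → x ∈ cs F (S ∩ A) := by
        intro A h h' j hj
        by_cases hjS : j ∈ S
        · exact h' j (fun hA => hj (Finset.mem_inter.2 ⟨hjS, hA⟩))
        · exact h j hjS
      have t1 := this A₁
      have t2 := this A₂
      simp only [Finset.mem_union, Finset.mem_filter, Finset.mem_univ, true_and]
      tauto
    have := (Finset.card_le_card hsub).trans ((Finset.card_union_le _ _).trans
      (Nat.add_le_add_left (Finset.card_union_le _ _) _))
    omega

lemma n_eq (q m a b : ℕ) (hq : 2 ≤ q) (hab : q ^ a + q ^ b ≤ q ^ m + 1) :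
    ((q ^ m - 1) / (q - 1) - (q ^ a + q ^ b - 2) / (q - 1)) * (q - 1) + q ^ a + q ^ b
      = q ^ m + 1 := by
  have hdv : ∀ t, q - 1 ∣ q ^ t - 1 := fun t => by simpa using Nat.sub_dvd_pow_sub_pow q 1 t
  have hp : ∀ t, 1 ≤ q ^ t := fun t => Nat.one_le_pow _ _ (by omega)
  have e : q ^ a + q ^ b - 2 = (q ^ a - 1) + (q ^ b - 1) := by
    have := hp a; have := hp b; omega
  rw [Nat.sub_mul, Nat.div_mul_cancel (hdv m), e, Nat.div_mul_cancel (Nat.dvd_add (hdv a) (hdv b))]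
  have := hp a; have := hp b; have := hp m
  omega

/-- With `n = (q^m-1)/(q-1) - (q^{|A₁|}+q^{|A₂|}-2)/(q-1)` and
`d = q^{m-1} - q^{|A₁|-1} - q^{|A₂|-1}` (for disjoint nonempty `A₁, A₂` of size at most `m-2`),
every `q`-ary linear code of length `n-q-1` and minimum distance `d` has dimension at most
`m-2`; consequently the dimension `m` of the `[n,m,d]` code `C_{D^c}` attains the generalized
Cadambe–Mazumdar bound `k ≤ min_{s ≥ 1} (2s + k_opt^{(q)}(n - s(q+1), d))` with equality. -/
theorem stmt14 {F : Type*} [Field F] [Fintype F] [DecidableEq F] {m q : ℕ}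
    (hq : Fintype.card F = q)
    (A₁ A₂ : Finset (Fin m)) (h1 : A₁.Nonempty) (h2 : A₂.Nonempty)
    (hdisj : Disjoint A₁ A₂) (hc1 : A₁.card ≤ m - 2) (hc2 : A₂.card ≤ m - 2) :
    let n := (q ^ m - 1) / (q - 1) - (q ^ A₁.card + q ^ A₂.card - 2) / (q - 1)
    let d := q ^ (m - 1) - q ^ (A₁.card - 1) - q ^ (A₂.card - 1)
    (∀ C : Submodule F (Fin (n - q - 1) → F),
      (∀ c ∈ C, c ≠ 0 → d ≤ hammingNorm c) →
      (∃ c ∈ C, c ≠ 0 ∧ hammingNorm c = d) →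
      Module.finrank F ↥C ≤ m - 2) ∧
    m = sInf {v | ∃ s : ℕ, 1 ≤ s ∧ v = 2 * s + kopt F (n - s * (q + 1)) d} := by
  classical
  intro n d
  have hq2 : 2 ≤ q := by rw [← hq]; exact Fintype.one_lt_card
  have ha := h1.card_pos
  have hb := h2.card_pos
  have hm : 3 ≤ m := by omega
  have hpm : q ^ (m - 1) = q ^ (m - 2) * q := by
    rw [← pow_succ]; congr 1; omega
  have hpm' : q ^ m = q ^ (m - 2) * q * q := by
    rw [← pow_succ, ← pow_succ]; congr 1; omega
  have hP : 1 ≤ q ^ (m - 2) := Nat.one_le_pow _ _ (by omega)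
  have pa : q ^ A₁.card ≤ q ^ (m - 2) := Nat.pow_le_pow_right (by omega) hc1
  have pb : q ^ A₂.card ≤ q ^ (m - 2) := Nat.pow_le_pow_right (by omega) hc2
  have sa : q ^ A₁.card = q ^ (A₁.card - 1) * q := by
    rw [← pow_succ]; congr 1; omega
  have sb : q ^ A₂.card = q ^ (A₂.card - 1) * q := by
    rw [← pow_succ]; congr 1; omega
  have ca : 1 ≤ q ^ (A₁.card - 1) := Nat.one_le_pow _ _ (by omega)
  have cb : 1 ≤ q ^ (A₂.card - 1) := Nat.one_le_pow _ _ (by omega)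
  have la : q ^ (A₁.card - 1) < q ^ (m - 2) := by nlinarith
  have lb : q ^ (A₂.card - 1) < q ^ (m - 2) := by nlinarith
  have hlt : q ^ (A₁.card - 1) + q ^ (A₂.card - 1) < q ^ (m - 1) := by nlinarith
  have hd0 : 0 < d := by simp only [d]; omega
  have hd : d + q ^ (A₁.card - 1) + q ^ (A₂.card - 1) = q ^ (m - 1) := by
    simp only [d]; omega
  have hn : n * (q - 1) + q ^ A₁.card + q ^ A₂.card = q ^ m + 1 :=
    n_eq q m _ _ hq2 (by nlinarith)
  clear_value n d
  have upper : ∀ C : Submodule F (Fin (n - (q + 1)) → F),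
      (∀ c ∈ C, c ≠ 0 → d ≤ hammingNorm c) → Module.finrank F ↥C ≤ m - 2 := by
    intro C hC
    by_contra hk
    push Not at hk
    have hle : Module.finrank F C ≤ n - (q + 1) := by simpa using Submodule.finrank_le C
    have hpl := plotkin C hC
    rw [hq] at hpl
    generalize Module.finrank F C = k at hk hle hpl
    obtain ⟨N, hN⟩ : ∃ N, n = N + (q + 1) := ⟨n - (q + 1), by omega⟩
    have hN' : n - (q + 1) = N := by omega
    have hpk : q ^ k = q ^ (k - 1) * q := by
      rw [← pow_succ]; congr 1; omega
    have hkm : q ^ (m - 2) ≤ q ^ (k - 1) :=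
      Nat.pow_le_pow_right (by omega) (by omega)
    rw [hN', hpk] at hpl
    generalize q ^ (k - 1) = Y at *
    obtain ⟨Z, hZ⟩ : ∃ Z, Y * q = Z + 1 := ⟨Y * q - 1, by
      have : 0 < Y * q := Nat.mul_pos (by omega) (by omega)
      omega⟩
    obtain ⟨p, rfl⟩ : ∃ p, q = p + 1 := ⟨q - 1, by omega⟩
    simp only [Nat.add_sub_cancel, hZ] at hpl hn
    generalize (p + 1) ^ (m - 2) = M at *
    rw [hpm', sa, sb] at hn
    rw [hpm] at hd
    generalize (p + 1) ^ (A₁.card - 1) = a at *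
    generalize (p + 1) ^ (A₂.card - 1) = b at *
    rw [hN] at hn
    -- q d = N (q - 1) + q^2 - 2
    have key : (p + 1) * d + 2 = N * p + (p + 1) ^ 2 := by
      zify at hd hn ⊢
      linear_combination ((p : ℤ) + 1) * hd - hn
    have hdM : d < M * (p + 1) := by omega
    have h3 : Y * ((p + 1) * d) ≤ d + Y * (N * p) := by
      have : (p + 1) * (Y * ((p + 1) * d)) ≤ (p + 1) * (d + Y * (N * p)) := by
        have e1 : (p + 1) * (Y * ((p + 1) * d)) = (p + 1) * (Z * d) + (p + 1) * d := by
          have : (p + 1) * (Y * ((p + 1) * d)) = (p + 1) * d * (Y * (p + 1)) := by ring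
          rw [this, hZ]; ring
        have e2 : N * (p * (Z + 1)) = (p + 1) * (Y * (N * p)) := by rw [← hZ]; ring
        rw [e1, mul_add, ← e2]; omega
      exact Nat.le_of_mul_le_mul_left this (by omega)
    have h4 : Y * ((p + 1) ^ 2) ≤ d + 2 * Y := by
      have : Y * ((p + 1) * d) + 2 * Y = Y * (N * p) + Y * (p + 1) ^ 2 := by
        linear_combination Y * key
      omega
    have hp1 : 1 ≤ p := by omega
    have h5 : M * (p + 1) ≤ Y * (p + 1) := Nat.mul_le_mul_right _ hkm
    have h6 : Y * 2 ≤ Y * (p * (p + 1)) := Nat.mul_le_mul_left _ (by nlinarith)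
    have h7 : Y * (p + 1) ^ 2 = Y * (p + 1) + Y * (p * (p + 1)) := by ring
    clear hd hn hpl hpm hpm' key h3
    linarith only [h4, h5, h6, h7, hdM]
  refine ⟨fun C hC _ => upper C hC, ?_⟩
  have lower : ∀ s, 1 ≤ s → m ≤ 2 * s + kopt F (n - s * (q + 1)) d := by
    intro s hs
    by_cases hsm : m ≤ 2 * s
    · omega
    push Not at hsm
    have hW : ∃ W : Submodule F (Fin m → F), Module.finrank F W ≤ 2 * s ∧
      (Fintype.card F - 1) * (s * (Fintype.card F + 1)) ≤
      (univ.filter (fun x => (x ∉ cs F A₁ ∧ x ∉ cs F A₂) ∧ x ∈ W)).card := by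
      rcases Nat.lt_or_ge s 2 with h | h
      · obtain rfl : s = 1 := by omega
        simpa using exists_line (F := F) A₁ A₂ (by omega) hc1 hc2
      · exact exists_W A₁ A₂ (by omega) hc1 hc2 h hsm.le
    obtain ⟨W, hW1, hW2⟩ := hW
    subst hq
    have := shorten A₁ A₂ h1 h2 hdisj hd hd0 hn W hW1 hW2
    convert this using 2
    congr!
  apply le_antisymm
  · apply le_csInf
    · exact ⟨_, 1, le_rfl, rfl⟩
    · rintro _ ⟨s, hs, rfl⟩
      exact lower s hs
  · have hmem : 2 * 1 + kopt F (n - 1 * (q + 1)) d ∈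
        {v | ∃ s : ℕ, 1 ≤ s ∧ v = 2 * s + kopt F (n - s * (q + 1)) d} := ⟨1, le_rfl, rfl⟩
    refine (Nat.sInf_le hmem).trans ?_
    rw [one_mul]
    have := kopt_le upper
    omega
end

section
/- Let q be a prime power, m ≥ 3, A ⊆ [m] with |A| = s ≥ 3, and let D = {d ∈ P_A : wt(d) = 2} (projective points supported on A of Hamming weight 2). Then |D| = (q−1)·C(s,2), and for every nonzero x ∈ F_q^m with wt(x_A) = a, the weight of the codeword c_x in C_{D^c} is wt(c_x) = ((q−1)/q)(N − (q−1)C(s,2)) + 1/q + (1/q)K_2(a; s, q), where N = (q^m−1)/(q−1). -/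
open Matrix Finset

/-- Points of `PG(m-1,q)`: nonzero vectors whose first nonzero coordinate is `1`. -/
def projPoints (F : Type*) [Field F] [Fintype F] [DecidableEq F] (m : ℕ) :
    Finset (Fin m → F) :=
  Finset.univ.filter fun v => ∃ i, v i = 1 ∧ ∀ j, j < i → v j = 0

/-- `P_A`: projective points supported on `A`. -/
def PA (F : Type*) [Field F] [Fintype F] [DecidableEq F] {m : ℕ} (A : Finset (Fin m)) :
    Finset (Fin m → F) :=
  (projPoints F m).filter fun v => ∀ i ∉ A, v i = 0


lemma aux_fiber {F : Type*} [Field F] [Fintype F] [DecidableEq F] {m : ℕ}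
    (x : Fin m → F) (hx : x ≠ 0) :
    Fintype.card F * (univ.filter fun v : Fin m → F => x ⬝ᵥ v = 1).card = Fintype.card F ^ m := by
  obtain ⟨k, hk⟩ : ∃ k, x k ≠ 0 := by
    by_contra h
    push Not at h
    exact hx (funext h)
  have h1 : ∀ c : F, (univ.filter fun v : Fin m → F => x ⬝ᵥ v = c).card
      = (univ.filter fun v : Fin m → F => x ⬝ᵥ v = 1).card := by
    intro c
    refine Finset.card_bij' (fun v _ => v + Pi.single k ((1 - c) / x k))
      (fun v _ => v - Pi.single k ((1 - c) / x k)) ?_ ?_ ?_ ?_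
    · intro v hv
      simp only [mem_filter, mem_univ, true_and] at hv ⊢
      rw [dotProduct_add, hv, dotProduct_single]
      field_simp
      ring
    · intro v hv
      simp only [mem_filter, mem_univ, true_and] at hv ⊢
      rw [dotProduct_sub, hv, dotProduct_single]
      field_simp
      ring
    · intro v _
      simp
    · intro v _
      simp
  have h2 := Finset.card_eq_sum_card_fiberwise (s := (univ : Finset (Fin m → F)))
    (t := (univ : Finset F)) (f := fun v => x ⬝ᵥ v) (by intro v _; simp)
  simp only [h1, sum_const, smul_eq_mul] at h2
  rw [Finset.card_univ, Finset.card_univ, Fintype.card_fun, Fintype.card_fin] at h2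
  exact h2.symm

lemma aux_lead {F : Type*} [Field F] {m : ℕ} (w w' : Fin m → F)
    (i i' : Fin m) (h1 : w i = 1) (h0 : ∀ j, j < i → w j = 0)
    (h1' : w' i' = 1) (h0' : ∀ j, j < i' → w' j = 0) (c c' : F) (hc : c ≠ 0) (hc' : c' ≠ 0)
    (h : c • w = c' • w') : w = w' := by
  have hi : i = i' := by
    rcases lt_trichotomy i i' with hl | hl | hl
    · have := congrFun h i
      simp [h1, h0' i hl, hc] at this
    · exact hl
    · have := congrFun h i'
      simp [h1', h0 i' hl, hc'] at this
      exact absurd this.symm hc'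
  subst hi
  have hcc : c = c' := by
    have := congrFun h i
    simpa [h1, h1'] using this
  subst hcc
  exact smul_right_injective _ hc h

lemma aux_proj {F : Type*} [Field F] [Fintype F] [DecidableEq F] {m : ℕ}
    (x : Fin m → F) :
    ((projPoints F m).filter fun v => x ⬝ᵥ v ≠ 0).card
      = (univ.filter fun v : Fin m → F => x ⬝ᵥ v = 1).card := by
  refine Finset.card_bij (fun v _ => (x ⬝ᵥ v)⁻¹ • v) ?_ ?_ ?_
  · intro v hv
    simp only [projPoints, mem_filter, mem_univ, true_and] at hv ⊢
    rw [dotProduct_smul, smul_eq_mul, inv_mul_cancel₀ hv.2]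
  · intro v hv w hw h
    simp only [projPoints, mem_filter, mem_univ, true_and] at hv hw
    obtain ⟨⟨i, h1, h0⟩, hv⟩ := hv
    obtain ⟨⟨i', h1', h0'⟩, hw⟩ := hw
    exact aux_lead v w i i' h1 h0 h1' h0' _ _ (inv_ne_zero hv) (inv_ne_zero hw) h
  · intro v hv
    simp only [mem_filter, mem_univ, true_and] at hv
    have hne : (univ.filter fun i => v i ≠ 0).Nonempty := by
      by_contra h
      rw [Finset.not_nonempty_iff_eq_empty, Finset.filter_eq_empty_iff] at h
      have : v = 0 := by
        funext i
        simpa using h (mem_univ i)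
      subst this
      simp at hv
    set i := (univ.filter fun i => v i ≠ 0).min' hne with hi
    have hvi : v i ≠ 0 := by
      have := Finset.min'_mem _ hne
      exact (mem_filter.mp this).2
    have hlt : ∀ j, j < i → v j = 0 := by
      intro j hj
      by_contra h
      have := Finset.min'_le (univ.filter fun i => v i ≠ 0) j (by simp [h])
      exact absurd hj (not_lt.mpr this)
    refine ⟨(v i)⁻¹ • v, ?_, ?_⟩
    · simp only [projPoints, mem_filter, mem_univ, true_and]
      refine ⟨⟨i, ?_, ?_⟩, ?_⟩
      · simp [hvi]
      · intro j hj
        simp [hlt j hj]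
      · rw [dotProduct_smul, hv]
        simpa using hvi
    · rw [dotProduct_smul, hv, smul_smul]
      simp [hvi]

lemma aux_D {F : Type*} [Field F] [Fintype F] [DecidableEq F] {m : ℕ} (A : Finset (Fin m))
    (P : (Fin m → F) → Prop) [DecidablePred P] :
    (((PA F A).filter fun v => hammingNorm v = 2).filter P).card
      = ∑ i ∈ A, ∑ j ∈ A, if i < j then
          (univ.filter fun t : F => t ≠ 0 ∧ P (Pi.single i 1 + Pi.single j t)).card else 0 := by
  have hT : ∑ i ∈ A, ∑ j ∈ A, (if i < j then
          (univ.filter fun t : F => t ≠ 0 ∧ P (Pi.single i 1 + Pi.single j t)).card else 0)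
      = (((A ×ˢ A) ×ˢ (univ : Finset F)).filter fun z => z.1.1 < z.1.2 ∧ z.2 ≠ 0 ∧
          P (Pi.single z.1.1 1 + Pi.single z.1.2 z.2)).card := by
    rw [card_filter, sum_product, sum_product]
    refine sum_congr rfl fun i _ => sum_congr rfl fun j _ => ?_
    by_cases h : i < j
    · rw [card_filter]
      simp only [h, true_and, if_true]
    · simp [h]
  rw [hT]
  symm
  refine Finset.card_bij (fun z _ => Pi.single z.1.1 1 + Pi.single z.1.2 z.2) ?_ ?_ ?_
  · rintro ⟨⟨i, j⟩, t⟩ hz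
    simp only [mem_filter, mem_product, mem_univ, and_true] at hz
    obtain ⟨⟨hi, hj⟩, hij, ht, hP⟩ := hz
    simp only [PA, projPoints, mem_filter, mem_univ, true_and]
    refine ⟨⟨⟨⟨i, ?_, ?_⟩, ?_⟩, ?_⟩, hP⟩
    · simp [hij.ne]
    · intro k hk
      simp [hk.ne, (hk.trans hij).ne]
    · intro k hk
      have h1 : k ≠ i := fun h => hk (h ▸ hi)
      have h2 : k ≠ j := fun h => hk (h ▸ hj)
      simp [h1, h2]
    · have : (univ.filter fun k => (Pi.single i (1 : F) + Pi.single j t : Fin m → F) k ≠ 0)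
          = {i, j} := by
        ext k
        simp only [mem_filter, mem_univ, true_and, mem_insert, mem_singleton]
        by_cases h1 : k = i
        · subst h1
          simp [hij.ne]
        · by_cases h2 : k = j
          · subst h2
            simp [h1, ht]
          · simp [h1, h2]
      unfold hammingNorm
      rw [this, card_pair hij.ne]
  · rintro ⟨⟨i, j⟩, t⟩ hz ⟨⟨i', j'⟩, t'⟩ hz' h
    simp only [mem_filter, mem_product, mem_univ, and_true] at hz hz' h
    obtain ⟨-, hij, ht, -⟩ := hz
    obtain ⟨-, hij', ht', -⟩ := hz'
    have e : ∀ k, (if k = i then (1 : F) else 0) + (if k = j then t else 0)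
        = (if k = i' then (1 : F) else 0) + (if k = j' then t' else 0) := by
      intro k
      have := congrFun h k
      simpa [Pi.single_apply] using this
    have e1 := e i
    have e2 := e j
    have e3 := e i'
    have e4 := e j'
    have hii : i = i' := by
      rcases lt_trichotomy i i' with hl | hl | hl
      · simp [hij.ne, hl.ne, (hl.trans hij').ne] at e1
      · exact hl
      · simp [hij'.ne, hl.ne, (hl.trans hij).ne] at e3
    subst hii
    have hjj : j = j' := by
      by_contra hne
      simp [hij.ne', hne, ht] at e2
    subst hjj
    simp [hij.ne'] at e2
    simp [e2]
  · intro v hv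
    simp only [PA, projPoints, mem_filter, mem_univ, true_and] at hv
    obtain ⟨⟨⟨⟨i, h1, h0⟩, hA⟩, hw⟩, hP⟩ := hv
    have hmem : i ∈ univ.filter fun k => v k ≠ 0 := by simp [h1]
    have hcard : ((univ.filter fun k => v k ≠ 0).erase i).card = 1 := by
      rw [card_erase_of_mem hmem]
      unfold hammingNorm at hw
      rw [hw]
    obtain ⟨j, hj⟩ := card_eq_one.mp hcard
    have hk : ∀ k, (k ≠ i ∧ v k ≠ 0) ↔ k = j := by
      intro k
      have := Finset.ext_iff.mp hj k
      simpa using this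
    obtain ⟨hji, hvj⟩ := (hk j).mpr rfl
    have hij : i < j := by
      rcases lt_trichotomy i j with hl | hl | hl
      · exact hl
      · exact absurd hl.symm hji
      · exact absurd (h0 j hl) hvj
    have hveq : (Pi.single i 1 + Pi.single j (v j) : Fin m → F) = v := by
      funext k
      by_cases hki : k = i
      · subst hki
        simp [hij.ne, h1]
      · by_cases hkj : k = j
        · subst hkj
          simp [hki]
        · have : v k = 0 := by
            by_contra h
            exact hkj ((hk k).mp ⟨hki, h⟩)
          simp [hki, hkj, this]
    refine ⟨((i, j), v j), ?_, hveq⟩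
    simp only [mem_filter, mem_product, mem_univ, and_true]
    refine ⟨⟨?_, ?_⟩, hij, hvj, ?_⟩
    · by_contra h
      simp [hA i h] at h1
    · by_contra h
      exact hvj (hA j h)
    · rw [hveq]
      exact hP

lemma aux_sym {m : ℕ} (A : Finset (Fin m)) (f : Fin m → Fin m → ℚ) (hf : ∀ i j, f i j = f j i) :
    2 * ∑ i ∈ A, ∑ j ∈ A, (if i < j then f i j else 0)
      = ∑ i ∈ A, ∑ j ∈ A, f i j - ∑ i ∈ A, f i i := by
  have h1 : ∑ i ∈ A, ∑ j ∈ A, f i j = ∑ i ∈ A, ∑ j ∈ A, ((if i < j then f i j else 0)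
      + (if j < i then f j i else 0) + (if i = j then f i i else 0)) := by
    refine sum_congr rfl fun i _ => sum_congr rfl fun j _ => ?_
    rcases lt_trichotomy i j with hl | hl | hl
    · simp [hl, hl.ne, hl.not_gt]
    · subst hl
      simp
    · simp [hl, hl.ne', hl.not_gt, hf i j]
  have h2 : ∑ i ∈ A, ∑ j ∈ A, (if j < i then f j i else 0)
      = ∑ i ∈ A, ∑ j ∈ A, (if i < j then f i j else 0) := sum_comm
  have h3 : ∑ i ∈ A, ∑ j ∈ A, (if i = j then f i i else 0) = ∑ i ∈ A, f i i := by
    refine sum_congr rfl fun i hi => ?_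
    simp [hi]
  rw [h1]
  simp only [sum_add_distrib]
  rw [h2, h3]
  ring

lemma aux_t {F : Type*} [Field F] [Fintype F] [DecidableEq F] (y z : F) :
    ((univ.filter fun t : F => t ≠ 0 ∧ y + z * t ≠ 0).card : ℚ)
      = ((Fintype.card F : ℚ) - 1) * ((if y ≠ 0 then 1 else 0) + (if z ≠ 0 then 1 else 0))
        - (Fintype.card F : ℚ) * ((if y ≠ 0 then 1 else 0) * (if z ≠ 0 then 1 else 0)) := by
  have hc : ((univ.filter fun t : F => t ≠ 0).card : ℚ) = (Fintype.card F : ℚ) - 1 := by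
    rw [Finset.filter_ne' univ (0 : F), card_erase_of_mem (mem_univ _), card_univ,
      Nat.cast_sub Fintype.card_pos]
    simp
  by_cases hy : y = 0
  · by_cases hz : z = 0
    · simp [hy, hz]
    · simp only [hy, hz, zero_add]
      simp only [ne_eq, mul_eq_zero, hz, false_or, and_self, not_true_eq_false, if_false,
        not_false_eq_true, if_true]
      simpa using hc
  · by_cases hz : z = 0
    · simp only [hy, hz, zero_mul]
      simpa [hy] using hc
    · have : (univ.filter fun t : F => t ≠ 0 ∧ y + z * t ≠ 0)
          = (univ.erase 0).erase (-y / z) := by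
        ext t
        simp only [mem_filter, mem_univ, true_and, mem_erase, and_true]
        rw [and_comm]
        refine and_congr_left fun _ => not_congr ?_
        rw [eq_div_iff hz]
        constructor
        · intro h
          linear_combination h
        · intro h
          linear_combination h
      rw [this, card_erase_of_mem (by simp [hy, hz]), card_erase_of_mem (mem_univ _), card_univ]
      have h2 : 2 ≤ Fintype.card F := Fintype.one_lt_card
      rw [Nat.sub_sub, Nat.cast_sub h2]
      simp [hy, hz]
      ring

/-- For `D` the weight-2 points of `P_A` (`|A| = s ≥ 3`): `|D| = (q-1)C(s,2)`, and for any
nonzero `x` with `wt(x_A) = a`, the weight of `c_x ∈ C_{D^c}` is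
`((q-1)/q)(N - (q-1)C(s,2)) + 1/q + (1/q)K_2(a;s,q)` where `N = (q^m-1)/(q-1)`. -/
theorem stmt17 {F : Type*} [Field F] [Fintype F] [DecidableEq F] {m s q : ℕ}
    (hq : Fintype.card F = q) (hm : 3 ≤ m) (A : Finset (Fin m)) (hA : A.card = s)
    (hs : 3 ≤ s) :
    let D := (PA F A).filter fun v => hammingNorm v = 2
    let Dc := projPoints F m \ D
    D.card = (q - 1) * s.choose 2 ∧
    ∀ x : Fin m → F, x ≠ 0 →
      let a := (A.filter fun i => x i ≠ 0).card
      let K2 : ℚ := ((s - a).choose 2 : ℚ) * ((q : ℚ) - 1) ^ 2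
        - (a : ℚ) * ((s : ℚ) - (a : ℚ)) * ((q : ℚ) - 1) + (a.choose 2 : ℚ)
      ((Dc.filter fun v => x ⬝ᵥ v ≠ 0).card : ℚ)
        = ((q : ℚ) - 1) / q * (((q : ℚ) ^ m - 1) / ((q : ℚ) - 1) - ((q : ℚ) - 1) * (s.choose 2 : ℚ))
          + 1 / q + 1 / q * K2 := by
  intro D Dc
  have hq2 : 2 ≤ q := hq ▸ Fintype.one_lt_card
  have hcs : ((s.choose 2 : ℕ) : ℚ) = s * (s - 1) / 2 := Nat.cast_choose_two ℚ s
  refine ⟨?_, ?_⟩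
  · have h := aux_D (F := F) A (fun _ => True)
    rw [Finset.filter_true] at h
    have hc : (univ.filter fun t : F => t ≠ 0 ∧ True).card = q - 1 := by
      simp only [and_true]
      rw [Finset.filter_ne' univ (0 : F), card_erase_of_mem (mem_univ _), card_univ, hq]
    simp only [hc] at h
    change D.card = _ at h
    have h' : (D.card : ℚ) = ((q - 1 : ℕ) : ℚ) * s.choose 2 := by
      rw [h]
      push_cast
      have := aux_sym A (fun _ _ => ((q - 1 : ℕ) : ℚ)) (fun _ _ => rfl)
      simp only [sum_const, hA, nsmul_eq_mul] at this
      rw [hcs]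
      linear_combination this / 2
    exact_mod_cast h'
  · intro x hx a K2
    have hE := aux_D (F := F) A (fun v => x ⬝ᵥ v ≠ 0)
    change (D.filter fun v => x ⬝ᵥ v ≠ 0).card = _ at hE
    have hsplit : (Dc.filter fun v => x ⬝ᵥ v ≠ 0)
        = ((projPoints F m).filter fun v => x ⬝ᵥ v ≠ 0) \ (D.filter fun v => x ⬝ᵥ v ≠ 0) := by
      ext v
      simp only [Dc, mem_filter, mem_sdiff]
      tauto
    have hsub : (D.filter fun v => x ⬝ᵥ v ≠ 0) ⊆ (projPoints F m).filter fun v => x ⬝ᵥ v ≠ 0 :=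
      filter_subset_filter _ ((filter_subset _ _).trans (filter_subset _ _))
    have hfib := aux_fiber x hx
    rw [← aux_proj x, hq] at hfib
    have hfibQ : (q : ℚ) * (((projPoints F m).filter fun v => x ⬝ᵥ v ≠ 0).card : ℚ)
        = (q : ℚ) ^ m := by exact_mod_cast hfib
    rw [hsplit, card_sdiff_of_subset hsub, Nat.cast_sub (card_le_card hsub)]
    set u : Fin m → ℚ := fun i => if x i ≠ 0 then 1 else 0 with hu
    have hua : ∑ i ∈ A, u i = a := by
      simp only [hu, a, sum_boole]
    have huu : ∀ i, u i * u i = u i := by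
      intro i
      simp only [hu]
      split_ifs <;> simp
    have hEQ : ((D.filter fun v => x ⬝ᵥ v ≠ 0).card : ℚ) = ∑ i ∈ A, ∑ j ∈ A,
        if i < j then ((q : ℚ) - 1) * (u i + u j) - q * (u i * u j) else 0 := by
      rw [hE]
      push_cast
      refine sum_congr rfl fun i _ => sum_congr rfl fun j _ => ?_
      refine if_congr Iff.rfl ?_ rfl
      have := aux_t (x i) (x j)
      rw [hq] at this
      rw [← this]
      simp only [dotProduct_add, dotProduct_single, mul_one]
    have hsym := aux_sym A (fun i j => ((q : ℚ) - 1) * (u i + u j) - q * (u i * u j))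
      (fun i j => by ring)
    rw [← hEQ] at hsym
    simp only [huu] at hsym
    simp only [sum_sub_distrib, ← mul_sum, sum_add_distrib, sum_const, hA, nsmul_eq_mul, hua,
      ← sum_mul] at hsym
    have has : a ≤ s := hA ▸ card_filter_le _ _
    have hca : ((a.choose 2 : ℕ) : ℚ) = a * (a - 1) / 2 := Nat.cast_choose_two ℚ a
    have hcsa : (((s - a).choose 2 : ℕ) : ℚ) = ((s : ℚ) - a) * ((s : ℚ) - a - 1) / 2 := by
      rw [Nat.cast_choose_two, Nat.cast_sub has]
    have hq0 : (q : ℚ) ≠ 0 := by positivity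
    have hq1 : (q : ℚ) - 1 ≠ 0 := by
      have : (2 : ℚ) ≤ q := by exact_mod_cast hq2
      linarith
    simp only [K2, hcs, hca, hcsa]
    generalize (((projPoints F m).filter fun v => x ⬝ᵥ v ≠ 0).card : ℚ) = X at *
    generalize ((D.filter fun v => x ⬝ᵥ v ≠ 0).card : ℚ) = Y at *
    rw [← hfibQ]
    field_simp
    linear_combination (-(q : ℚ)) * hsym
end
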